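/- arXiv:math/0201311 — 2 statements merged into one kernel-verified Lean document; each statement's English description precedes it below -/
import Mathlib

section
/- Let q be a power of an odd prime and write 2q-1 = F^2·D with D squarefree and F a positive integer. Then the complex number π = (F·√(2D) + √−2)/2 is a root of f_q = x^4 + (2-2q)x^2 + q^2, and ℚ(π) = ℚ(√−2, √−D) as subfields of ℂ. -/
noncomputable section
open Complex

/-- `√−2 = i·√2` -/
def sm2 : ℂ := Complex.I * Real.sqrt 2
/-- `√−D = i·√D` -/
def smD (D : ℕ) : ℂ := Complex.I * Real.sqrt D
/-- `√(2D)` -/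
def s2D (D : ℕ) : ℂ := (Real.sqrt (2 * D) : ℝ)
/-- `K = ℚ(√−2, √−D)` as a subfield of `ℂ`. -/
def Kf (D : ℕ) : IntermediateField ℚ ℂ := IntermediateField.adjoin ℚ {sm2, smD D}

theorem sm2_sq : sm2 ^ 2 = -2 := by
  have h : ((Real.sqrt 2 : ℝ) : ℂ) ^ 2 = 2 := by
    exact_mod_cast Real.sq_sqrt (by norm_num : (0 : ℝ) ≤ 2)
  rw [sm2, mul_pow, Complex.I_sq, h]
  ring

theorem smD_sq (D : ℕ) : smD D ^ 2 = -D := by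
  have h : ((Real.sqrt D : ℝ) : ℂ) ^ 2 = D := by
    exact_mod_cast Real.sq_sqrt (Nat.cast_nonneg (α := ℝ) D)
  rw [smD, mul_pow, Complex.I_sq, h]
  ring

theorem s2D_eq_neg_mul (D : ℕ) : s2D D = -(sm2 * smD D) := by
  rw [s2D, sm2, smD, Real.sqrt_mul (by norm_num : (0 : ℝ) ≤ 2)]
  push_cast
  linear_combination (Real.sqrt 2 : ℂ) * (Real.sqrt D : ℂ) * Complex.I_sq

/-- Let `q` be a power of an odd prime, and write `2q − 1 = F²·D` with `D` squarefree
and `F` positive.  Then `π = (F·√(2D) + √−2)/2` is a root of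
`f_q = x⁴ + (2−2q)x² + q²`, and `ℚ(π) = ℚ(√−2, √−D)` as subfields of `ℂ`. -/
theorem pi_root_and_generates (q p n F D : ℕ) (hp : p.Prime) (hodd : Odd p)
    (hn : 0 < n) (hq : q = p ^ n) (hF : 0 < F) (hD : Squarefree D)
    (hFD : 2 * q = F ^ 2 * D + 1) (π : ℂ)
    (hπ : π = ((F : ℂ) * s2D D + sm2) / 2) :
    π ^ 4 + ((2 : ℂ) - 2 * q) * π ^ 2 + (q : ℂ) ^ 2 = 0 ∧
      IntermediateField.adjoin ℚ {π} = Kf D := by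
  have h2 := sm2_sq
  have hd := smD_sq D
  have hFD' : (2 : ℂ) * q = F ^ 2 * D + 1 := by exact_mod_cast hFD
  have hq0 : (q : ℂ) ≠ 0 := by
    rw [hq]
    exact_mod_cast (pow_pos hp.pos n).ne'
  have hF0 : (F : ℂ) ≠ 0 := by exact_mod_cast hF.ne'
  have hπ' : 2 * π = sm2 * (1 - F * smD D) := by
    rw [hπ, s2D_eq_neg_mul]
    ring
  have hsq : π ^ 2 = q - 1 + F * smD D := by
    linear_combination (π / 2 + sm2 * (1 - F * smD D) / 4) * hπ' +
      ((1 - F * smD D) ^ 2 / 4) * h2 - (F ^ 2 / 2) * hd - (1 / 2) * hFD'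
  have hne : (q : ℂ) - π ^ 2 ≠ 0 := by
    intro h
    apply hq0
    have h1 : (F : ℂ) * smD D = 1 := by linear_combination -h - hsq
    linear_combination (1 / 2) * hFD' + (F ^ 2 / 2) * hd - ((F * smD D + 1) / 2) * h1
  refine ⟨?_, le_antisymm ?_ ?_⟩
  · linear_combination (π ^ 2 - (q - 1) + F * smD D) * hsq + F ^ 2 * hd + hFD'
  · rw [IntermediateField.adjoin_le_iff, Set.singleton_subset_iff]
    have m2 : sm2 ∈ Kf D := IntermediateField.subset_adjoin ℚ _ (by simp)
    have mD : smD D ∈ Kf D := IntermediateField.subset_adjoin ℚ _ (by simp)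
    have e : π = sm2 * (1 - F * smD D) / 2 := by linear_combination hπ' / 2
    change π ∈ Kf D
    rw [e]
    exact div_mem (mul_mem m2 (sub_mem (one_mem _) (mul_mem (natCast_mem _ F) mD)))
      (ofNat_mem _ 2)
  · have mπ : π ∈ IntermediateField.adjoin ℚ {π} :=
      IntermediateField.mem_adjoin_simple_self ℚ π
    have eD : smD D = (π ^ 2 - (q - 1)) / F := by
      rw [eq_div_iff hF0]
      linear_combination -hsq
    have e2 : sm2 = 2 * π / (q - π ^ 2) := by
      rw [eq_div_iff hne]
      linear_combination -hπ' - sm2 * hsq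
    rw [Kf, IntermediateField.adjoin_le_iff, Set.pair_subset_iff]
    change sm2 ∈ IntermediateField.adjoin ℚ {π} ∧ smD D ∈ IntermediateField.adjoin ℚ {π}
    rw [e2, eD]
    exact ⟨div_mem (mul_mem (ofNat_mem _ 2) mπ) (sub_mem (natCast_mem _ q) (pow_mem mπ 2)),
      div_mem (sub_mem (pow_mem mπ 2) (sub_mem (natCast_mem _ q) (one_mem _)))
        (natCast_mem _ F)⟩
end
end

section
/- Let 𝔄 be an invertible fractional R_f-ideal. Then the invertible fractional R_f-ideal 𝔄·𝔄̄ lies in the image of the extension map 𝔅 ↦ 𝔅·R_f from the group of invertible fractional R⁺_f-ideals to the group of invertible fractional R_f-ideals (this extension map is injective, since R_f is flat over R⁺_f). -/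
noncomputable section
open Complex Pointwise

/-- `w = (√(2D) + √−2)/2` -/
def w (D : ℕ) : ℂ := (s2D D + sm2) / 2
/-- `𝒪 = ℤ[√−2]` -/
def OO : Subring ℂ := Subring.closure {sm2}
/-- `R_f = 𝒪 + f·w·𝒪 = ℤ[√−2, f·w]`, an order in `K`. -/
def Rf (D f : ℕ) : Subring ℂ := Subring.closure {sm2, (f : ℂ) * w D}
/-- `R⁺_f = ℤ[f·√(2D)]`, an order in `K⁺`. -/
def Rpf (D f : ℕ) : Subring ℂ := Subring.closure {(f : ℂ) * s2D D}
/-- `S_f = ℤ[f·√−D]`, an order in `L`. -/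
def Sf (D f : ℕ) : Subring ℂ := Subring.closure {(f : ℂ) * smD D}
/-- `K⁺ = ℚ(√(2D))`, the maximal real subfield of `K`. -/
def Kp (D : ℕ) : IntermediateField ℚ ℂ := IntermediateField.adjoin ℚ {s2D D}
/-- `L = ℚ(√−D)` -/
def Lf (D : ℕ) : IntermediateField ℚ ℂ := IntermediateField.adjoin ℚ {smD D}

/-- The complex conjugate `𝔄̄` of a fractional ideal `𝔄` of a subring of `ℂ`. -/
def conjSubmodule (R : Subring ℂ) (A : Submodule R ℂ) : Submodule R ℂ :=
  Submodule.span R ((starRingEnd ℂ) '' (A : Set ℂ))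

/-- An additive subgroup pair whose products all lie in the union of two additive subgroups
has all its products in one of the two. -/
lemma mul_mem_or_mul_mem_of_mul_mem_union (A B G H : AddSubgroup ℂ)
    (h : ∀ a ∈ A, ∀ b ∈ B, a * b ∈ G ∨ a * b ∈ H) :
    (∀ a ∈ A, ∀ b ∈ B, a * b ∈ G) ∨ (∀ a ∈ A, ∀ b ∈ B, a * b ∈ H) := by
  have union : ∀ (X P Q : AddSubgroup ℂ), (∀ x ∈ X, x ∈ P ∨ x ∈ Q) →
      (∀ x ∈ X, x ∈ P) ∨ (∀ x ∈ X, x ∈ Q) := by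
    intro X P Q hX
    by_contra! hne
    obtain ⟨⟨x, hx, hxP⟩, y, hy, hyQ⟩ := hne
    have hxQ := (hX x hx).resolve_left hxP
    have hyP := (hX y hy).resolve_right hyQ
    rcases hX (x + y) (X.add_mem hx hy) with h1 | h1
    · exact hxP ((P.add_mem_cancel_right hyP).1 h1)
    · exact hyQ ((Q.add_mem_cancel_left hxQ).1 h1)
  have left : ∀ b ∈ B, (∀ a ∈ A, a * b ∈ G) ∨ (∀ a ∈ A, a * b ∈ H) := fun b hb =>
    union A (G.comap (AddMonoidHom.mulRight b)) (H.comap (AddMonoidHom.mulRight b))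
      fun a ha => h a ha b hb
  let T : AddSubgroup ℂ → AddSubgroup ℂ := fun G =>
    ⨅ a : A, G.comap (AddMonoidHom.mulLeft (a : ℂ))
  have hT : ∀ G b, b ∈ T G ↔ ∀ a ∈ A, a * b ∈ G := by
    intro G b
    simp [T, AddSubgroup.mem_iInf]
  have := union B (T G) (T H) fun b hb => by simpa only [hT] using left b hb
  simp only [hT] at this
  exact this.imp (fun h a ha b hb => h b hb a ha) (fun h a ha b hb => h b hb a ha)

/-- The span over a subring `S` of the norms `a * ā` of the elements of `A`. -/
def normSpan {R : Subring ℂ} (S : Subring ℂ) (A : Submodule R ℂ) : Submodule S ℂ :=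
  Submodule.span S ((fun a : ℂ => a * starRingEnd ℂ a) '' (A : Set ℂ))

lemma norm_mem_normSpan {R S : Subring ℂ} {A : Submodule R ℂ} {a : ℂ} (ha : a ∈ A) :
    a * starRingEnd ℂ a ∈ normSpan S A :=
  Submodule.subset_span ⟨a, ha, rfl⟩

lemma mem_of_mul_eq_one {R : Subring ℂ} {A B : Submodule R ℂ} (hAB : A * B = 1)
    {a b : ℂ} (ha : a ∈ A) (hb : b ∈ B) : a * b ∈ R := by
  have h : a * b ∈ (1 : Submodule R ℂ) := hAB ▸ Submodule.mul_mem_mul ha hb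
  obtain ⟨r, hr⟩ := Submodule.mem_one.1 h
  exact hr ▸ r.2

/-- If `R` is stable under conjugation with real subring `S`, the norm spans of mutually
inverse `R`-submodules are mutually inverse. -/
lemma normSpan_mul_normSpan {R S : Subring ℂ} (hSR : S ≤ R)
    (hconj : ∀ x ∈ R, starRingEnd ℂ x ∈ R)
    (hreal : ∀ x ∈ R, starRingEnd ℂ x = x → x ∈ S)
    {A B : Submodule R ℂ} (hAB : A * B = 1) :
    normSpan S A * normSpan S B = 1 := by
  have hnorm : ∀ x ∈ R, x * starRingEnd ℂ x ∈ S := fun x hx =>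
    hreal _ (R.mul_mem hx (hconj x hx)) (by simp [mul_comm])
  apply le_antisymm
  · rw [normSpan, normSpan, Submodule.span_mul_span, Submodule.span_le]
    rintro _ ⟨_, ⟨a, ha, rfl⟩, _, ⟨b, hb, rfl⟩, rfl⟩
    refine Submodule.mem_one.2 ⟨⟨_, hnorm _ (mem_of_mul_eq_one hAB ha hb)⟩, ?_⟩
    change a * b * starRingEnd ℂ (a * b) = _
    simp only [map_mul]
    ring
  · let I : Ideal S := (normSpan S A * normSpan S B).comap (Algebra.linearMap S ℂ)
    have hI : I = ⊤ := by
      by_contra hne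
      obtain ⟨m, hm, hIm⟩ := Ideal.exists_le_maximal I hne
      let _ : Algebra S R := (Subring.inclusion hSR).toAlgebra
      have hint : Algebra.IsIntegral S R := by
        refine ⟨fun x => ?_⟩
        have ht : (x : ℂ) + starRingEnd ℂ x ∈ S :=
          hreal _ (R.add_mem x.2 (hconj _ x.2)) (by simp [add_comm])
        refine ⟨Polynomial.X ^ 2 - (Polynomial.C ⟨_, ht⟩ * Polynomial.X
          - Polynomial.C ⟨_, hnorm _ x.2⟩), ?_, ?_⟩
        · apply Polynomial.monic_X_pow_sub
          compute_degree
          norm_num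
        · apply Subtype.ext
          simp only [Polynomial.eval₂_sub, Polynomial.eval₂_mul, Polynomial.eval₂_pow,
            Polynomial.eval₂_X, Polynomial.eval₂_C]
          change (x : ℂ) ^ 2 - (((x : ℂ) + starRingEnd ℂ x) * x
            - (x : ℂ) * starRingEnd ℂ x) = 0
          ring
      have hinj : Function.Injective (algebraMap S R) := Subring.inclusion_injective hSR
      obtain ⟨M, hM, hMm⟩ := Ideal.exists_ideal_over_maximal_of_isIntegral (S := R) m (by
        rw [(RingHom.injective_iff_ker_eq_bot _).1 hinj]; exact bot_le)
      let G : AddSubgroup ℂ := M.toAddSubgroup.map R.subtype.toAddMonoidHom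
      have hG : ∀ x (hx : x ∈ R), x ∈ G ↔ (⟨x, hx⟩ : R) ∈ M := by
        intro x hx
        constructor
        · rintro ⟨y, hy, rfl⟩
          exact hy
        · exact fun h => ⟨_, h, rfl⟩
      let H : AddSubgroup ℂ := G.comap (starRingEnd ℂ).toAddMonoidHom
      have h1R : (1 : ℂ) ∉ G := fun h =>
        hM.ne_top ((Ideal.eq_top_iff_one _).2 ((hG 1 R.one_mem).1 h))
      have key : ∀ a ∈ A.toAddSubgroup, ∀ b ∈ B.toAddSubgroup, a * b ∈ G ∨ a * b ∈ H := by
        intro a ha b hb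
        have hab := mem_of_mul_eq_one hAB ha hb
        have hmem : (⟨_, hnorm _ hab⟩ : S) ∈ I := by
          change a * b * starRingEnd ℂ (a * b) ∈ normSpan S A * normSpan S B
          have := Submodule.mul_mem_mul (norm_mem_normSpan (S := S) ha)
            (norm_mem_normSpan (S := S) hb)
          convert this using 1
          simp only [map_mul]
          ring
        have h2 := hIm hmem
        rw [← hMm, Ideal.mem_comap] at h2
        have h3 : (⟨a * b, hab⟩ : R) * ⟨starRingEnd ℂ (a * b), hconj _ hab⟩ ∈ M := h2
        exact (hM.isPrime.mem_or_mem h3).imp (hG _ _).2 (hG _ (hconj _ hab)).2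
      have hone : (1 : ℂ) ∈ A * B := hAB ▸ Submodule.mem_one.2 ⟨1, map_one _⟩
      have ind : ∀ P : AddSubgroup ℂ, (∀ a ∈ A, ∀ b ∈ B, a * b ∈ P) → (1 : ℂ) ∈ P :=
        fun P hP => Submodule.mul_induction_on hone hP fun _ _ => P.add_mem
      rcases mul_mem_or_mul_mem_of_mul_mem_union _ _ _ _ key with h | h
      · exact h1R (ind G h)
      · have : starRingEnd ℂ 1 ∈ G := ind H h
        exact h1R (by simpa using this)
    have h1 : (1 : S) ∈ I := hI ▸ Submodule.mem_top
    rw [Submodule.one_le]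
    simpa [I] using h1

lemma span_normSpan_eq {R S : Subring ℂ} (hSR : S ≤ R)
    (hconj : ∀ x ∈ R, starRingEnd ℂ x ∈ R)
    (hreal : ∀ x ∈ R, starRingEnd ℂ x = x → x ∈ S)
    {A B : Submodule R ℂ} (hAB : A * B = 1) :
    Submodule.span R (normSpan S A : Set ℂ) = A * conjSubmodule R A := by
  apply le_antisymm
  · rw [Submodule.span_le]
    intro x hx
    refine Submodule.span_induction (p := fun x _ => x ∈ A * conjSubmodule R A) ?_
      (Submodule.zero_mem _) (fun _ _ _ _ => Submodule.add_mem _)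
      (fun (r : S) x _ hx => Submodule.smul_mem _ (⟨r, hSR r.2⟩ : R) hx) hx
    rintro _ ⟨a, ha, rfl⟩
    exact Submodule.mul_mem_mul ha (Submodule.subset_span ⟨a, ha, rfl⟩)
  · have hone : (1 : ℂ) ∈ normSpan S A * normSpan S B := by
      rw [normSpan_mul_normSpan hSR hconj hreal hAB]
      exact Submodule.mem_one.2 ⟨1, map_one _⟩
    have key : ∀ a ∈ A, ∀ a' ∈ A,
        a * starRingEnd ℂ a' ∈ Submodule.span R (normSpan S A : Set ℂ) := by
      intro a ha a' ha'
      have hB : ∀ d ∈ normSpan S B, a * starRingEnd ℂ a' * d ∈ R := by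
        intro d hd
        refine Submodule.span_induction (p := fun d _ => a * starRingEnd ℂ a' * d ∈ R)
          ?_ (by simp) ?_ ?_ hd
        · rintro _ ⟨b, hb, rfl⟩
          have := R.mul_mem (mem_of_mul_eq_one hAB ha hb)
            (hconj _ (mem_of_mul_eq_one hAB ha' hb))
          convert this using 1
          simp only [map_mul]
          ring
        · intro x y _ _ hx hy
          rw [mul_add]
          exact R.add_mem hx hy
        · intro r x _ hx
          have := R.mul_mem (hSR r.2) hx
          convert this using 1
          rw [Subring.smul_def, smul_eq_mul]
          ring
      have : ∀ y ∈ normSpan S A * normSpan S B,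
          a * starRingEnd ℂ a' * y ∈ Submodule.span R (normSpan S A : Set ℂ) := by
        intro y hy
        refine Submodule.mul_induction_on hy ?_ ?_
        · intro c hc d hd
          have := Submodule.smul_mem (Submodule.span R (normSpan S A : Set ℂ))
            (⟨_, hB d hd⟩ : R) (Submodule.subset_span hc)
          convert this using 1
          rw [Subring.smul_def, smul_eq_mul]
          ring
        · intro x y hx hy
          rw [mul_add]
          exact Submodule.add_mem _ hx hy
      simpa using this 1 hone
    rw [Submodule.mul_le]
    intro a ha x hx
    refine Submodule.span_induction
      (p := fun x _ => a * x ∈ Submodule.span R (normSpan S A : Set ℂ)) ?_ (by simp) ?_ ?_ hx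
    · rintro _ ⟨a', ha', rfl⟩
      exact key a ha a' ha'
    · intro x y _ _ hx hy
      rw [mul_add]
      exact Submodule.add_mem _ hx hy
    · intro r x _ hx
      rw [mul_smul_comm]
      exact Submodule.smul_mem _ _ hx

lemma sm2_mul_self : sm2 * sm2 = -2 := by
  have h : ((Real.sqrt 2 : ℝ) : ℂ) * (Real.sqrt 2 : ℝ) = 2 := by
    rw [← Complex.ofReal_mul, Real.mul_self_sqrt (by norm_num)]
    norm_num
  unfold sm2
  linear_combination (Complex.I * Complex.I) * h + 2 * Complex.I_mul_I

lemma s2D_mul_self (D : ℕ) : s2D D * s2D D = 2 * D := by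
  unfold s2D
  rw [← Complex.ofReal_mul, Real.mul_self_sqrt (by positivity)]
  push_cast
  ring

lemma sm2_ne_zero : sm2 ≠ 0 := by
  intro h
  have := sm2_mul_self
  simp [h] at this

lemma conj_sm2 : starRingEnd ℂ sm2 = -sm2 := by
  simp [sm2]

lemma conj_s2D (D : ℕ) : starRingEnd ℂ (s2D D) = s2D D := by
  simp [s2D]

lemma two_mul_w (D : ℕ) : 2 * w D = s2D D + sm2 := by
  unfold w
  ring

lemma smD_eq (D : ℕ) : smD D = s2D D * sm2 / 2 := by
  have h : ((Real.sqrt 2 : ℝ) : ℂ) * (Real.sqrt 2 : ℝ) = 2 := by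
    rw [← Complex.ofReal_mul, Real.mul_self_sqrt (by norm_num)]
    norm_num
  unfold smD s2D sm2
  rw [Real.sqrt_mul (by norm_num)]
  push_cast
  linear_combination (-Complex.I * (Real.sqrt D : ℝ) / 2) * h

lemma w_mul_self (D : ℕ) (hD4 : D % 4 = 1) :
    w D * w D = sm2 * w D + ((D / 2 + 1 : ℕ) : ℂ) := by
  have hD : (D : ℂ) = 2 * ((D / 2 : ℕ) : ℂ) + 1 := by
    have : D = 2 * (D / 2) + 1 := by omega
    exact_mod_cast this
  have h := s2D_mul_self D
  have h2 := sm2_mul_self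
  unfold w
  push_cast
  linear_combination h / 4 - h2 / 4 + hD / 2

lemma f_mul_s2D_mem_Rf (D f : ℕ) : (f : ℂ) * s2D D ∈ Rf D f := by
  have h1 : sm2 ∈ Rf D f := Subring.subset_closure (by simp)
  have h2 : (f : ℂ) * w D ∈ Rf D f := Subring.subset_closure (by simp)
  have := sub_mem (add_mem h2 h2) (mul_mem (natCast_mem (Rf D f) f) h1)
  convert this using 1
  linear_combination (-(f : ℂ)) * two_mul_w D

lemma Rpf_le_Rf (D f : ℕ) : Rpf D f ≤ Rf D f := by
  rw [Rpf, Subring.closure_le, Set.singleton_subset_iff]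
  exact f_mul_s2D_mem_Rf D f

lemma conj_mem_Rf (D f : ℕ) : ∀ x ∈ Rf D f, starRingEnd ℂ x ∈ Rf D f := by
  have h1 : sm2 ∈ Rf D f := Subring.subset_closure (by simp)
  have h2 : (f : ℂ) * w D ∈ Rf D f := Subring.subset_closure (by simp)
  suffices h : Rf D f ≤ (Rf D f).comap (starRingEnd ℂ) from h
  conv_lhs => rw [Rf]
  rw [Subring.closure_le]
  rintro x (rfl | rfl)
  · simpa [conj_sm2] using h1
  · have := sub_mem h2 (mul_mem (natCast_mem (Rf D f) f) h1)
    change starRingEnd ℂ _ ∈ Rf D f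
    convert this using 1
    simp only [w, map_mul, map_div₀, map_add, conj_sm2, conj_s2D, map_natCast, map_ofNat]
    ring

/-- Coordinates of elements of `R_f` in the basis `1, √−2, f·w, f·w·√−2`. -/
lemma exists_coords_of_mem_Rf (D f : ℕ) (hD4 : D % 4 = 1) {x : ℂ} (hx : x ∈ Rf D f) :
    ∃ a b c d : ℤ, x = a + b * sm2 + c * (f * w D) + d * (f * w D * sm2) := by
  induction hx using Subring.closure_induction with
  | mem x hx =>
    rcases hx with rfl | rfl
    · exact ⟨0, 1, 0, 0, by simp⟩
    · exact ⟨0, 0, 1, 0, by simp⟩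
  | zero => exact ⟨0, 0, 0, 0, by simp⟩
  | one => exact ⟨1, 0, 0, 0, by simp⟩
  | add x y _ _ hx hy =>
    obtain ⟨a, b, c, d, rfl⟩ := hx
    obtain ⟨a', b', c', d', rfl⟩ := hy
    exact ⟨a + a', b + b', c + c', d + d', by push_cast; ring⟩
  | neg x _ hx =>
    obtain ⟨a, b, c, d, rfl⟩ := hx
    exact ⟨-a, -b, -c, -d, by push_cast; ring⟩
  | mul x y _ _ hx hy =>
    obtain ⟨a, b, c, d, rfl⟩ := hx
    obtain ⟨a', b', c', d', rfl⟩ := hy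
    have h2 := sm2_mul_self
    have hw := w_mul_self D hD4
    set N : ℕ := D / 2 + 1
    refine ⟨a * a' - 2 * b * b' + f ^ 2 * N * (c * c' - 2 * d * d'),
      a * b' + b * a' + f ^ 2 * N * (c * d' + d * c'),
      a * c' + c * a' - 2 * (b * d' + d * b') - 2 * f * (c * d' + d * c'),
      a * d' + d * a' + b * c' + c * b' + f * (c * c' - 2 * d * d'), ?_⟩
    push_cast
    linear_combination ((b : ℂ) * b' + (b * d' + d * b') * f * w D
      + d * d' * f ^ 2 * (sm2 * w D + N) + (c * d' + d * c') * f ^ 2 * w D) * h2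
      + (c + d * sm2) * (c' + d' * sm2) * f ^ 2 * hw

lemma irrational_sqrt_two_mul (D : ℕ) (hD4 : D % 4 = 1) : Irrational (Real.sqrt (2 * D)) := by
  have h : ¬ IsSquare (2 * D) := by
    rintro ⟨r, hr⟩
    rcases Nat.even_or_odd' r with ⟨k, rfl | rfl⟩
    · have : 2 * D = 4 * (k * k) := by rw [hr]; ring
      omega
    · have : 2 * D = 2 * (2 * (k * k) + 2 * k) + 1 := by rw [hr]; ring
      omega
  have := irrational_sqrt_natCast_iff.2 h
  push_cast at this
  exact this

lemma mem_Rpf_of_real (D f : ℕ) (hD4 : D % 4 = 1) (hf1 : Odd f) :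
    ∀ x ∈ Rf D f, starRingEnd ℂ x = x → x ∈ Rpf D f := by
  intro x hx hreal
  have hf0 : f ≠ 0 := by rintro rfl; simp at hf1
  obtain ⟨a, b, c, d, rfl⟩ := exists_coords_of_mem_Rf D f hD4 hx
  have h2 := sm2_mul_self
  have him : ((2 * b + c * f : ℤ) : ℂ) + (d * f : ℤ) * s2D D = 0 := by
    simp only [w, map_mul, map_div₀, map_add, conj_sm2, conj_s2D, map_natCast, map_ofNat,
      map_intCast] at hreal
    have : sm2 * (((2 * b + c * f : ℤ) : ℂ) + (d * f : ℤ) * s2D D) = 0 := by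
      push_cast
      linear_combination -hreal
    exact (mul_eq_zero.1 this).resolve_left sm2_ne_zero
  have him' : ((2 * b + c * f : ℤ) : ℝ) + (d * f : ℤ) * Real.sqrt (2 * D) = 0 := by
    unfold s2D at him
    exact_mod_cast him
  have hd : d = 0 := by
    by_contra hd
    have hdf : d * (f : ℤ) ≠ 0 := mul_ne_zero hd (by exact_mod_cast hf0)
    exact (((irrational_sqrt_two_mul D hD4).intCast_mul hdf).intCast_add (2 * b + c * f)).ne_zero
      him'
  subst hd
  have hbc : 2 * b + c * f = 0 := by
    have : ((2 * b + c * f : ℤ) : ℝ) = 0 := by simpa using him'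
    exact_mod_cast this
  have hc : Even c := by
    have : Even (c * (f : ℤ)) := ⟨-b, by linarith⟩
    rcases Int.even_mul.1 this with h | h
    · exact h
    · exact absurd ((Int.even_coe_nat f).1 h) (Nat.not_even_iff_odd.2 hf1)
  obtain ⟨k, rfl⟩ := hc
  have hb : b = -(k * f) := by linarith
  subst hb
  have h3 : (f : ℂ) * s2D D ∈ Rpf D f := Subring.subset_closure (by simp)
  have := add_mem (intCast_mem (Rpf D f) a) (mul_mem (intCast_mem (Rpf D f) k) h3)
  convert this using 1
  push_cast
  linear_combination (k : ℂ) * f * two_mul_w D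

lemma conj_eq_self_of_mem_Kp (D : ℕ) {x : ℂ} (hx : x ∈ Kp D) : starRingEnd ℂ x = x := by
  induction hx using IntermediateField.adjoin_induction with
  | mem x hx =>
    rw [Set.mem_singleton_iff] at hx
    rw [hx, conj_s2D]
  | algebraMap q => simp
  | add x y _ _ hx hy => rw [map_add, hx, hy]
  | inv x _ hx => rw [map_inv₀, hx]
  | mul x y _ _ hx hy => rw [map_mul, hx, hy]

lemma norm_mem_Kp (D : ℕ) {x : ℂ} (hx : x ∈ Kf D) : x * starRingEnd ℂ x ∈ Kp D := by
  have h2 := sm2_mul_self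
  have conj_add : ∀ p ∈ Kp D, ∀ q ∈ Kp D, starRingEnd ℂ (p + q * sm2) = p - q * sm2 := by
    intro p hp q hq
    rw [map_add, map_mul, conj_eq_self_of_mem_Kp D hp, conj_eq_self_of_mem_Kp D hq, conj_sm2]
    ring
  have norm_eq : ∀ p q : ℂ, (p + q * sm2) * (p - q * sm2) = p * p + (q * q + q * q) := by
    intro p q
    linear_combination -(q * q) * h2
  have norm_mem : ∀ p ∈ Kp D, ∀ q ∈ Kp D, p * p + (q * q + q * q) ∈ Kp D :=
    fun p hp q hq => add_mem (mul_mem hp hp) (add_mem (mul_mem hq hq) (mul_mem hq hq))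
  suffices h : ∃ p ∈ Kp D, ∃ q ∈ Kp D, x = p + q * sm2 by
    obtain ⟨p, hp, q, hq, rfl⟩ := h
    rw [conj_add p hp q hq, norm_eq]
    exact norm_mem p hp q hq
  have hs : s2D D ∈ Kp D := IntermediateField.subset_adjoin _ _ (by simp)
  induction hx using IntermediateField.adjoin_induction with
  | mem x hx =>
    rcases hx with rfl | rfl
    · exact ⟨0, zero_mem _, 1, one_mem _, by simp⟩
    · refine ⟨0, zero_mem _, s2D D / 2, div_mem hs (ofNat_mem _ 2), ?_⟩
      rw [smD_eq]
      ring
  | algebraMap q => exact ⟨_, (Kp D).algebraMap_mem q, 0, zero_mem _, by simp⟩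
  | add x y _ _ hx hy =>
    obtain ⟨p, hp, q, hq, rfl⟩ := hx
    obtain ⟨p', hp', q', hq', rfl⟩ := hy
    exact ⟨p + p', add_mem hp hp', q + q', add_mem hq hq', by ring⟩
  | inv x _ hx =>
    obtain ⟨p, hp, q, hq, rfl⟩ := hx
    refine ⟨p / (p * p + (q * q + q * q)), div_mem hp (norm_mem p hp q hq),
      -q / (p * p + (q * q + q * q)), div_mem (neg_mem hq) (norm_mem p hp q hq), ?_⟩
    by_cases h0 : p + q * sm2 = 0
    · have h1 := norm_eq p q
      rw [h0, zero_mul] at h1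
      simp [h0, ← h1]
    · have h1 : p - q * sm2 ≠ 0 := by
        rw [← conj_add p hp q hq]
        exact (map_ne_zero _).2 h0
      rw [← norm_eq]
      field_simp
      ring
  | mul x y _ _ hx hy =>
    obtain ⟨p, hp, q, hq, rfl⟩ := hx
    obtain ⟨p', hp', q', hq', rfl⟩ := hy
    refine ⟨p * p' - (q * q' + q * q'),
      sub_mem (mul_mem hp hp') (add_mem (mul_mem hq hq') (mul_mem hq hq')),
      p * q' + q * p', add_mem (mul_mem hp hq') (mul_mem hq hp'), ?_⟩
    linear_combination q * q' * h2

lemma Rpf_le_Kp (D f : ℕ) : ∀ x ∈ Rpf D f, x ∈ Kp D := by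
  suffices h : Rpf D f ≤ (Kp D).toSubring from h
  rw [Rpf, Subring.closure_le, Set.singleton_subset_iff]
  exact mul_mem (natCast_mem (Kp D) f) (IntermediateField.subset_adjoin _ _ (by simp))

lemma normSpan_subset_Kp (D f : ℕ) {A : Submodule (Rf D f) ℂ} (hAK : (A : Set ℂ) ⊆ Kf D) :
    (normSpan (Rpf D f) A : Set ℂ) ⊆ Kp D := by
  intro x hx
  refine Submodule.span_induction (p := fun x _ => x ∈ Kp D) ?_ (zero_mem _)
    (fun _ _ _ _ => add_mem) (fun (r : Rpf D f) x _ hx => mul_mem (Rpf_le_Kp D f r r.2) hx) hx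
  rintro _ ⟨a, ha, rfl⟩
  exact norm_mem_Kp D (hAK ha)

/-- Let `𝔄` be an invertible fractional `R_f`-ideal.  Then `𝔄·𝔄̄` lies in the image
of the extension map `𝔅 ↦ 𝔅·R_f` from invertible fractional `R⁺_f`-ideals to
invertible fractional `R_f`-ideals. -/
theorem norm_of_ideal_comes_from_real_subring (D : ℕ) (hD0 : 0 < D)
    (hDsf : Squarefree D) (hD4 : D % 4 = 1) (f : ℕ) (hf1 : Odd f) (hf0 : 0 < f)
    (A : Submodule (Rf D f) ℂ) (hAK : (A : Set ℂ) ⊆ Kf D)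
    (hAinv : ∃ B : Submodule (Rf D f) ℂ, A * B = 1) :
    ∃ C : Submodule (Rpf D f) ℂ, (C : Set ℂ) ⊆ Kp D ∧
      (∃ C' : Submodule (Rpf D f) ℂ, C * C' = 1) ∧
      Submodule.span (Rf D f) (C : Set ℂ) = A * conjSubmodule (Rf D f) A := by
  obtain ⟨B, hAB⟩ := hAinv
  have hSR := Rpf_le_Rf D f
  have hconj := conj_mem_Rf D f
  have hreal := mem_Rpf_of_real D f hD4 hf1
  exact ⟨normSpan (Rpf D f) A, normSpan_subset_Kp D f hAK,
    ⟨normSpan (Rpf D f) B, normSpan_mul_normSpan hSR hconj hreal hAB⟩,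
    span_normSpan_eq hSR hconj hreal hAB⟩
end
end
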